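/- For every CNF formula φ with no clause containing both a literal and its negation, φ is unsatisfiable if and only if na_c(F_φ) = cl-naive(F_φ), where F_φ is the reduction CAF of φ. Equivalently, φ is unsatisfiable if and only if the family na_c(F_φ) is incomparable. -/

import Mathlib

/-- A set `E` of arguments is conflict-free w.r.t. attack relation `R`:
no argument in `E` attacks another argument in `E`. -/
def ConflictFree {α : Type*} (R : α → α → Prop) (E : Set α) : Prop :=
  ∀ a ∈ E, ∀ b ∈ E, ¬ R a b

/-- A set `E` is naive iff it is ⊆-maximal among conflict-free sets. -/
def Naive {α : Type*} (R : α → α → Prop) (E : Set α) : Prop :=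
  ConflictFree R E ∧ ∀ E', ConflictFree R E' → E ⊆ E' → E' = E

/-- Inherited naive semantics: claim-sets of naive extensions. -/
def naC {α γ : Type*} (R : α → α → Prop) (cl : α → γ) : Set (Set γ) :=
  {S | ∃ E, Naive R E ∧ S = cl '' E}

/-- Claim-sets of conflict-free sets. -/
def cfC {α γ : Type*} (R : α → α → Prop) (cl : α → γ) : Set (Set γ) :=
  {S | ∃ E, ConflictFree R E ∧ S = cl '' E}

/-- Claim-level naive semantics: ⊆-maximal claim-sets of conflict-free sets. -/
def clNaive {α γ : Type*} (R : α → α → Prop) (cl : α → γ) : Set (Set γ) :=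
  {S | S ∈ cfC R cl ∧ ∀ T ∈ cfC R cl, S ⊆ T → T = S}

/-- A family of sets is incomparable if no member is a strict subset of another. -/
def Incomparable {γ : Type*} (S : Set (Set γ)) : Prop :=
  ∀ S1 ∈ S, ∀ S2 ∈ S, ¬ S1 ⊂ S2

/-- Arguments of the reduction CAF `F_φ` for a CNF formula over atoms `X`
with clause index set `I`: an argument `pos x` for each atom `x`, an argument
`neg x` (i.e. `x̄`) for each atom, an argument `cls i` for each clause,
and the arguments `φ`, `a1`, `a2`. -/
inductive RArg (X I : Type*) where
  | pos : X → RArg X I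
  | neg : X → RArg X I
  | cls : I → RArg X I
  | phi : RArg X I
  | a1 : RArg X I
  | a2 : RArg X I

/-- Claims of the reduction CAF: each atom argument, negated-atom argument,
clause argument and `φ` has its own claim; `a1` and `a2` share the fresh claim `a`. -/
inductive RClaim (X I : Type*) where
  | pos : X → RClaim X I
  | neg : X → RClaim X I
  | cls : I → RClaim X I
  | phi : RClaim X I
  | a : RClaim X I

/-- The claim function of the reduction CAF. -/
def rcl {X I : Type*} : RArg X I → RClaim X I
  | .pos x => .pos x
  | .neg x => .neg x
  | .cls i => .cls i
  | .phi => .phi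
  | .a1 => .a
  | .a2 => .a

/-- The attack relation of the reduction CAF, where clause `i` has positive
literals `P i` and negative literals `N i`:  `x` attacks clause `i` if `x ∈ P i`,
`x̄` attacks clause `i` if `¬x ∈ cl_i` (i.e. `x ∈ N i`), `x` and `x̄` attack each
other, every clause attacks `φ`, and `φ` attacks `a2`. -/
def rAtt {X I : Type*} (P N : I → Set X) : RArg X I → RArg X I → Prop := fun u v =>
  match u, v with
  | .pos x, .cls i => x ∈ P i
  | .neg x, .cls i => x ∈ N i
  | .pos x, .neg y => x = y
  | .neg x, .pos y => x = y
  | .cls _, .phi => True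
  | .phi, .a2 => True
  | _, _ => False

/-- No clause contains both a literal and its negation. -/
def NonTaut {X I : Type*} (P N : I → Set X) : Prop :=
  ∀ i : I, ∀ x : X, ¬ (x ∈ P i ∧ x ∈ N i)

/-- `M ⊆ X` is a model of the CNF formula: every clause contains a positive
literal in `M` or a negative literal whose atom is not in `M`. -/
def IsModel {X I : Type*} (P N : I → Set X) (M : Set X) : Prop :=
  ∀ i : I, (∃ x ∈ P i, x ∈ M) ∨ (∃ x ∈ N i, x ∉ M)

/-- The formula is satisfiable if it has a model. -/
def Satisfiable {X I : Type*} (P N : I → Set X) : Prop :=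
  ∃ M : Set X, IsModel P N M

/-- The naive extension `E = M ∪ {x̄ : x ∉ M} ∪ {φ, a1}` built from a model `M`. -/
def Ephi {X I : Type*} (M : Set X) : Set (RArg X I) :=
  (RArg.pos '' M) ∪ (RArg.neg '' Mᶜ) ∪ {RArg.phi, RArg.a1}

/-- The naive extension `E' = M ∪ {x̄ : x ∉ M} ∪ {a1, a2}` built from a model `M`. -/
def Ea {X I : Type*} (M : Set X) : Set (RArg X I) :=
  (RArg.pos '' M) ∪ (RArg.neg '' Mᶜ) ∪ {RArg.a1, RArg.a2}

/-- Every conflict-free set is contained in a naive one. -/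
theorem ConflictFree.exists_naive_superset {α : Type*} {R : α → α → Prop} {E : Set α}
    (hE : ConflictFree R E) : ∃ E', Naive R E' ∧ E ⊆ E' := by
  obtain ⟨M, hEM, hM⟩ := zorn_subset_nonempty {E | ConflictFree R E}
    (fun c hc hchain _ => ⟨⋃₀ c, by
      rintro a ⟨s, hs, ha⟩ b ⟨t, ht, hb⟩
      rcases hchain.total hs ht with h | h
      · exact hc ht a (h ha) b hb
      · exact hc hs a ha b (h hb), fun s hs => Set.subset_sUnion_of_mem hs⟩) E hE
  exact ⟨M, ⟨hM.prop, fun E' h' hsub => (hM.eq_of_subset h' hsub).symm⟩, hEM⟩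

/-- An argument in no conflict with itself or a naive set belongs to that set. -/
theorem Naive.mem {α : Type*} {R : α → α → Prop} {E : Set α} (hE : Naive R E) {a : α}
    (haa : ¬ R a a) (h : ∀ b ∈ E, ¬ R a b ∧ ¬ R b a) : a ∈ E := by
  have key := hE.2 (insert a E) (by
    rintro b (rfl | hb) c (rfl | hc)
    · exact haa
    · exact (h c hc).1
    · exact (h b hb).2
    · exact hE.1 b hb c hc) (Set.subset_insert a E)
  exact key ▸ Set.mem_insert a E

/-- The inherited and claim-level naive semantics coincide iff the former is incomparable. -/
theorem naC_eq_clNaive_iff {α γ : Type*} (R : α → α → Prop) (cl : α → γ) :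
    naC R cl = clNaive R cl ↔ Incomparable (naC R cl) := by
  constructor
  · intro h S₁ h₁ S₂ h₂ hlt
    rw [h] at h₁ h₂
    exact hlt.ne (h₁.2 S₂ h₂.1 hlt.subset).symm
  · intro h
    ext S
    constructor
    · rintro ⟨E, hE, rfl⟩
      refine ⟨⟨E, hE.1, rfl⟩, ?_⟩
      rintro _ ⟨F, hF, rfl⟩ hsub
      obtain ⟨G, hG, hFG⟩ := hF.exists_naive_superset
      by_contra hne
      exact h _ ⟨E, hE, rfl⟩ _ ⟨G, hG, rfl⟩
        ((hsub.ssubset_of_ne (Ne.symm hne)).trans_subset (Set.image_mono hFG))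
    · rintro ⟨⟨E, hE, rfl⟩, hmax⟩
      obtain ⟨G, hG, hEG⟩ := hE.exists_naive_superset
      exact ⟨G, hG, (hmax _ ⟨G, hG.1, rfl⟩ (Set.image_mono hEG)).symm⟩

section Reduction

variable {X I : Type*} {P N : I → Set X}

theorem Naive.a1_mem {E : Set (RArg X I)} (hE : Naive (rAtt P N) E) : RArg.a1 ∈ E :=
  hE.mem (by simp [rAtt]) fun b _ => by cases b <;> simp [rAtt]

theorem Naive.a2_mem {E : Set (RArg X I)} (hE : Naive (rAtt P N) E) (h : RArg.phi ∉ E) :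
    RArg.a2 ∈ E :=
  hE.mem (by simp [rAtt]) fun b hb => by cases b <;> simp_all [rAtt]

/-- A naive set containing neither `φ` nor a clause argument yields a model. -/
theorem Naive.satisfiable {E : Set (RArg X I)} (hE : Naive (rAtt P N) E)
    (hphi : RArg.phi ∉ E) (hcls : ∀ i, RArg.cls i ∉ E) : Satisfiable P N := by
  refine ⟨{x | RArg.pos x ∈ E}, fun i => ?_⟩
  by_contra! hcon
  refine hcls i (hE.mem (by simp [rAtt]) fun b hb => ?_)
  cases b with
  | pos x => exact ⟨by simp [rAtt], fun hx => hcon.1 x hx hb⟩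
  | neg x =>
    exact ⟨by simp [rAtt], fun hx => hE.1 _ (hcon.2 x hx) _ hb (by simp [rAtt])⟩
  | cls j => simp [rAtt]
  | phi => exact absurd hb hphi
  | a1 => simp [rAtt]
  | a2 => simp [rAtt]

theorem incomparable_naC_of_not_satisfiable (h : ¬ Satisfiable P N) :
    Incomparable (naC (rAtt P N) rcl) := by
  rintro _ ⟨E, hE, rfl⟩ _ ⟨F, hF, rfl⟩ hlt
  have hmem : ∀ b ∈ E, ∃ c ∈ F, rcl c = rcl b :=
    fun b hb => hlt.subset (Set.mem_image_of_mem rcl hb)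
  have hcls : ∀ i, RArg.cls i ∈ E → RArg.cls i ∈ F := fun i hi => by
    obtain ⟨c, hc, hcb⟩ := hmem _ hi
    cases c <;> simp_all [rcl]
  have hsub : E ⊆ F := by
    intro b hb
    obtain ⟨c, hc, hcb⟩ := hmem b hb
    cases b with
    | a1 => exact hF.a1_mem
    | a2 =>
      have hphi : RArg.phi ∉ E := fun hp => hE.1 _ hp _ hb (by simp [rAtt])
      refine hF.a2_mem fun hp => h (hE.satisfiable hphi fun i hi => ?_)
      exact hF.1 _ (hcls i hi) _ hp (by simp [rAtt])
    | _ => cases c <;> simp_all [rcl]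
  exact hlt.ne (by rw [hE.2 F hF.1 hsub])

theorem naive_Ephi (M : Set X) : Naive (rAtt P N) (Ephi M) := by
  refine ⟨?_, fun F hF hsub => (Set.Subset.antisymm hsub fun b hb => ?_).symm⟩
  · intro a ha b hb
    cases a <;> cases b <;> simp_all [Ephi, rAtt] <;> grind
  · have hphi : RArg.phi ∈ F := hsub (by simp [Ephi])
    cases b with
    | pos x =>
      by_contra hx
      exact hF _ hb (RArg.neg x) (hsub (by simp_all [Ephi])) (by simp [rAtt])
    | neg x =>
      by_contra hx
      exact hF _ hb (RArg.pos x) (hsub (by simp_all [Ephi])) (by simp [rAtt])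
    | cls i => exact absurd (by simp [rAtt]) (hF _ hb _ hphi)
    | a2 => exact absurd (by simp [rAtt]) (hF _ hphi _ hb)
    | _ => simp [Ephi]

theorem IsModel.naive_Ea {M : Set X} (hM : IsModel P N M) : Naive (rAtt P N) (Ea M) := by
  refine ⟨?_, fun F hF hsub => (Set.Subset.antisymm hsub fun b hb => ?_).symm⟩
  · intro a ha b hb
    cases a <;> cases b <;> simp_all [Ea, rAtt] <;> grind
  · have ha2 : RArg.a2 ∈ F := hsub (by simp [Ea])
    cases b with
    | pos x =>
      by_contra hx
      exact hF _ hb (RArg.neg x) (hsub (by simp_all [Ea])) (by simp [rAtt])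
    | neg x =>
      by_contra hx
      exact hF _ hb (RArg.pos x) (hsub (by simp_all [Ea])) (by simp [rAtt])
    | cls i =>
      rcases hM i with ⟨x, hx, hxM⟩ | ⟨x, hx, hxM⟩
      · exact absurd hx (hF (RArg.pos x) (hsub (by simp_all [Ea])) _ hb)
      · exact absurd hx (hF (RArg.neg x) (hsub (by simp_all [Ea])) _ hb)
    | phi => exact absurd (by simp [rAtt]) (hF _ hb _ ha2)
    | _ => simp [Ea]

theorem image_rcl_Ea_ssubset (M : Set X) :
    rcl '' (Ea M : Set (RArg X I)) ⊂ rcl '' (Ephi M : Set (RArg X I)) := by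
  rw [Set.ssubset_iff_of_subset]
  · refine ⟨.phi, ⟨.phi, by simp [Ephi], rfl⟩, ?_⟩
    rintro ⟨c, hc, h⟩
    cases c <;> simp_all [rcl, Ea]
  · rintro _ ⟨c, hc, rfl⟩
    cases c with
    | a2 => exact ⟨.a1, by simp [Ephi], rfl⟩
    | _ => exact ⟨_, by simp_all [Ea, Ephi], rfl⟩

theorem not_satisfiable_iff_incomparable_naC :
    ¬ Satisfiable P N ↔ Incomparable (naC (rAtt P N) rcl) := by
  refine ⟨incomparable_naC_of_not_satisfiable, ?_⟩
  rintro h ⟨M, hM⟩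
  exact h _ ⟨_, hM.naive_Ea, rfl⟩ _ ⟨_, naive_Ephi M, rfl⟩ (image_rcl_Ea_ssubset M)

end Reduction

/-- `φ` is unsatisfiable iff `na_c(F_φ) = cl-naive(F_φ)`, and
equivalently iff `na_c(F_φ)` is incomparable. -/
theorem unsat_iff_concurrent {X I : Type*} [Fintype X] [Fintype I]
    (P N : I → Set X) (hNT : NonTaut P N) :
    (¬ Satisfiable P N ↔ naC (rAtt P N) rcl = clNaive (rAtt P N) rcl) ∧
    (¬ Satisfiable P N ↔ Incomparable (naC (rAtt P N) rcl)) :=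
  ⟨not_satisfiable_iff_incomparable_naC.trans (naC_eq_clNaive_iff _ _).symm,
    not_satisfiable_iff_incomparable_naC⟩
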